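/- There exists a finite set C ⊆ ℤ² that is a simple closed 8-curve — i.e., C is 8-connected and every point of C has exactly two 8-adjacent points in C — such that ℤ² \ C is 8-connected. Hence the Jordan separation property fails when 8-adjacency is used for both a simple closed curve and its complement. -/

import Mathlib

/-- 4-adjacency on ℤ². -/
def Adj4 (p q : ℤ × ℤ) : Prop := |p.1 - q.1| + |p.2 - q.2| = 1

/-- 8-adjacency on ℤ². -/
def Adj8 (p q : ℤ × ℤ) : Prop := max |p.1 - q.1| |p.2 - q.2| = 1 ∧ p ≠ q

/-- `p` and `q` are joined by a path within `A` whose consecutive points are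
`adj`-adjacent. -/
def ReachIn (adj : ℤ × ℤ → ℤ × ℤ → Prop) (A : Set (ℤ × ℤ)) (p q : ℤ × ℤ) : Prop :=
  Relation.ReflTransGen (fun a b => a ∈ A ∧ b ∈ A ∧ adj a b) p q

/-- `A` is `adj`-connected. -/
def IsConn (adj : ℤ × ℤ → ℤ × ℤ → Prop) (A : Set (ℤ × ℤ)) : Prop :=
  ∀ p ∈ A, ∀ q ∈ A, ReachIn adj A p q

/-- The 8-connected components of `A`: its maximal 8-connected subsets. -/
def Components8 (A : Set (ℤ × ℤ)) : Set (Set (ℤ × ℤ)) :=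
  {D | ∃ p ∈ A, D = {q ∈ A | ReachIn Adj8 A p q}}


theorem Adj8.symm {p q : ℤ × ℤ} (h : Adj8 p q) : Adj8 q p := by
  refine ⟨?_, h.2.symm⟩
  rw [abs_sub_comm q.1, abs_sub_comm q.2]
  exact h.1

theorem ReachIn.symm {A : Set (ℤ × ℤ)} {p q : ℤ × ℤ} (h : ReachIn Adj8 A p q) :
    ReachIn Adj8 A q p := by
  induction h with
  | refl => exact .refl
  | tail _ hbc ih => exact .head ⟨hbc.2.1, hbc.1, hbc.2.2.symm⟩ ih

/-- A set is 8-connected if every point other than `b` has an 8-neighbour in the set at which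
`μ` is smaller. -/
theorem isConn_adj8_of_descent {A : Set (ℤ × ℤ)} (b : ℤ × ℤ) (μ : ℤ × ℤ → ℕ)
    (h : ∀ p ∈ A, p ≠ b → ∃ q ∈ A, Adj8 p q ∧ μ q < μ p) : IsConn Adj8 A := by
  have reach : ∀ n : ℕ, ∀ p ∈ A, μ p < n → ReachIn Adj8 A p b := by
    intro n
    induction n with
    | zero => intro p _ hn; omega
    | succ n ih =>
      intro p hp hn
      by_cases hb : p = b
      · exact hb ▸ .refl
      · obtain ⟨q, hq, hadj, hlt⟩ := h p hp hb
        exact .head ⟨hp, hq, hadj⟩ (ih q hq (by omega))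
  intro p hp q hq
  exact (reach _ p hp (Nat.lt_succ_self _)).trans (reach _ q hq (Nat.lt_succ_self _)).symm

/-- The four points of ℤ² at ℓ¹-distance one from the origin. -/
def diamond : Set (ℤ × ℤ) := {p | |p.1| + |p.2| = 1}

theorem mem_diamond_iff {x y : ℤ} : (x, y) ∈ diamond ↔
    x = 1 ∧ y = 0 ∨ x = -1 ∧ y = 0 ∨ x = 0 ∧ y = 1 ∨ x = 0 ∧ y = -1 := by
  simp only [diamond, Set.mem_ofPred_eq, Int.abs_eq_natAbs]
  omega

theorem adj8_iff {x y u v : ℤ} : Adj8 (x, y) (u, v) ↔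
    (x - u ≤ 1 ∧ u - x ≤ 1 ∧ y - v ≤ 1 ∧ v - y ≤ 1) ∧ ¬(x = u ∧ y = v) := by
  simp only [Adj8, ne_eq, Prod.mk.injEq, Int.abs_eq_natAbs]
  omega

theorem finite_diamond : diamond.Finite := by
  refine (Set.finite_Icc ((-1, -1) : ℤ × ℤ) (1, 1)).subset ?_
  rintro ⟨x, y⟩ h
  rw [mem_diamond_iff] at h
  simp only [Set.mem_Icc, Prod.mk_le_mk]
  omega

theorem isConn_adj8_diamond : IsConn Adj8 diamond := by
  refine isConn_adj8_of_descent (0, 1) (fun p => (1 - p.2).toNat) ?_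
  rintro ⟨x, y⟩ hp hb
  rw [mem_diamond_iff] at hp
  simp only [ne_eq, Prod.mk.injEq] at hb
  by_cases hy : y = 0
  · refine ⟨(0, 1), ?_⟩
    simp only [mem_diamond_iff, adj8_iff, and_self, true_or, or_true, true_and]
    omega
  · refine ⟨(1, 0), ?_⟩
    simp only [mem_diamond_iff, adj8_iff, and_self, true_or, true_and]
    omega

theorem ncard_adj8_diamond {p : ℤ × ℤ} (hp : p ∈ diamond) :
    {q ∈ diamond | Adj8 p q}.ncard = 2 := by
  obtain ⟨x, y⟩ := p
  rw [mem_diamond_iff] at hp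
  rw [Set.ncard_eq_two]
  refine ⟨(y, x), (-y, -x), ?_, ?_⟩
  · simp only [ne_eq, Prod.mk.injEq]
    omega
  · ext ⟨u, v⟩
    simp only [Set.mem_ofPred_eq, Set.mem_insert_iff, Set.mem_singleton_iff, Prod.mk.injEq,
      mem_diamond_iff, adj8_iff]
    omega

theorem isConn_adj8_compl_diamond : IsConn Adj8 diamondᶜ := by
  refine isConn_adj8_of_descent (0, 0) (fun p => max p.1.natAbs p.2.natAbs) ?_
  rintro ⟨x, y⟩ hp hb
  rw [Set.mem_compl_iff, mem_diamond_iff] at hp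
  simp only [ne_eq, Prod.mk.injEq] at hb
  by_cases hc : x.natAbs = 1 ∧ y.natAbs = 1
  · refine ⟨(0, 0), ?_⟩
    simp only [Set.mem_compl_iff, mem_diamond_iff, adj8_iff]
    omega
  · have inward (t : ℤ) : ∃ s : ℤ, s ≠ 0 ∧ t - s ≤ 1 ∧ s - t ≤ 1 ∧
        (s.natAbs < t.natAbs ∨ s.natAbs = 1 ∧ t.natAbs ≤ 1) := by
      rcases lt_trichotomy t 0 with h | h | h
      · exact ⟨min (t + 1) (-1), by omega⟩
      · exact ⟨1, by omega⟩
      · exact ⟨max (t - 1) 1, by omega⟩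
    obtain ⟨u, hu⟩ := inward x
    obtain ⟨v, hv⟩ := inward y
    refine ⟨(u, v), ?_⟩
    simp only [Set.mem_compl_iff, mem_diamond_iff, adj8_iff]
    omega

/-- **Failure of Jordan separation for 8-adjacency.**
There is a finite simple closed 8-curve `C ⊆ ℤ²` (8-connected, with every point of `C`
having exactly two 8-adjacent points in `C`) whose complement `ℤ² \ C` is 8-connected. -/
theorem jordan_fails_for_eight_adjacency :
    ∃ C : Set (ℤ × ℤ), C.Finite ∧ IsConn Adj8 C ∧
      (∀ p ∈ C, {q ∈ C | Adj8 p q}.ncard = 2) ∧ IsConn Adj8 Cᶜ := by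
  exact ⟨diamond, finite_diamond, isConn_adj8_diamond, fun _ hp => ncard_adj8_diamond hp,
    isConn_adj8_compl_diamond⟩
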